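/- arXiv:math/0306107 — 4 statements merged into one kernel-verified Lean document; each statement's English description precedes it below -/
import Mathlib

section
/- Let n ≥ 1 and let A be an n × n complex matrix. A complex number c is an eigenvalue of the ℂ-linear endomorphism X ↦ X·A − A·X of the space of n × n complex matrices if and only if c = λ − μ for some eigenvalues λ and μ of A. -/
open Polynomial in
/-- An intertwining relation `x * a = b * x` extends to polynomials in `a` and `b`. -/
theorem SemiconjBy.aeval_right {R S : Type*} [CommSemiring R] [Semiring S] [Algebra R S]
    {x a b : S} (h : SemiconjBy x a b) (p : R[X]) : SemiconjBy x (aeval a p) (aeval b p) := by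
  induction p using Polynomial.induction_on' with
  | add p q hp hq => simpa using hp.add_right hq
  | monomial k r =>
    simp only [aeval_monomial]
    exact SemiconjBy.mul_right (Algebra.commutes r x).symm (h.pow_right k)

namespace Matrix

variable {ι K : Type*} [Fintype ι] [DecidableEq ι] [Field K]

theorem hasEigenvalue_toLin'_iff_mem_spectrum {A : Matrix ι ι K} {μ : K} :
    Module.End.HasEigenvalue (toLin' A) μ ↔ μ ∈ spectrum K A := by
  rw [Module.End.hasEigenvalue_iff_mem_spectrum, spectrum_toLin']

/-- An eigenvalue of a matrix has a right eigenvector. -/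
theorem exists_mulVec_eq_smul_of_mem_spectrum {A : Matrix ι ι K} {μ : K}
    (h : μ ∈ spectrum K A) : ∃ v ≠ 0, A *ᵥ v = μ • v := by
  obtain ⟨v, hv⟩ := (hasEigenvalue_toLin'_iff_mem_spectrum.2 h).exists_hasEigenvector
  exact ⟨v, hv.2, by simpa using hv.apply_eq_smul⟩

/-- An eigenvalue of a matrix has a left eigenvector. -/
theorem exists_vecMul_eq_smul_of_mem_spectrum {A : Matrix ι ι K} {μ : K}
    (h : μ ∈ spectrum K A) : ∃ w ≠ 0, w ᵥ* A = μ • w := by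
  have hT : μ ∈ spectrum K Aᵀ := by
    rwa [mem_spectrum_iff_isRoot_charpoly, charpoly_transpose,
      ← mem_spectrum_iff_isRoot_charpoly]
  simpa only [mulVec_transpose] using exists_mulVec_eq_smul_of_mem_spectrum hT

/-- If a nonzero matrix intertwines `A` and `B`, then `A` and `B` share an eigenvalue. -/
theorem exists_mem_spectrum_of_semiconjBy [IsAlgClosed K] {A B X : Matrix ι ι K} (hX : X ≠ 0)
    (h : SemiconjBy X A B) : ∃ μ, μ ∈ spectrum K A ∧ μ ∈ spectrum K B := by
  have hunit : ¬IsUnit (Polynomial.aeval B A.charpoly) := fun hu => hX <| by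
    have := (h.aeval_right A.charpoly).eq
    rw [aeval_self_charpoly, mul_zero] at this
    exact hu.mul_right_eq_zero.1 this.symm
  obtain ⟨μ, hμ, hroot⟩ := spectrum.exists_mem_of_not_isUnit_aeval_prod
    (p := A.charpoly) (a := B) (by
      rwa [← (IsAlgClosed.splits A.charpoly).eq_prod_roots_of_monic A.charpoly_monic])
  exact ⟨μ, mem_spectrum_iff_isRoot_charpoly.2 hroot, hμ⟩

end Matrix


/-- For an `n × n` complex matrix `A` (`n ≥ 1`), a complex number `c` is an eigenvalue of
the `ℂ`-linear endomorphism `X ↦ X·A − A·X` of `Mₙ(ℂ)` if and only if `c = λ − μ` for some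
eigenvalues `λ`, `μ` of `A`. -/
theorem eigenvalues_of_commutator_map (n : ℕ) (hn : 1 ≤ n)
    (A : Matrix (Fin n) (Fin n) ℂ) (c : ℂ) :
    Module.End.HasEigenvalue
      (LinearMap.mulRight ℂ A - LinearMap.mulLeft ℂ A) c ↔
    ∃ l m : ℂ, Module.End.HasEigenvalue (Matrix.toLin' A) l ∧
      Module.End.HasEigenvalue (Matrix.toLin' A) m ∧ c = l - m := by
  simp only [Matrix.hasEigenvalue_toLin'_iff_mem_spectrum]
  constructor
  · intro h
    obtain ⟨X, hX⟩ := h.exists_hasEigenvector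
    have hXA : X * A - A * X = c • X := by simpa using hX.apply_eq_smul
    have hsemi : SemiconjBy X A (algebraMap ℂ _ c + A) := by
      rw [SemiconjBy, add_mul, ← Algebra.smul_def, ← hXA, sub_add_cancel]
    obtain ⟨l, hl, hl'⟩ := Matrix.exists_mem_spectrum_of_semiconjBy hX.2 hsemi
    refine ⟨l, l - c, hl, ?_, by ring⟩
    rw [spectrum.mem_iff] at hl' ⊢
    rwa [map_sub, sub_sub]
  · rintro ⟨l, m, hl, hm, rfl⟩
    obtain ⟨v, hv, hAv⟩ := Matrix.exists_mulVec_eq_smul_of_mem_spectrum hm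
    obtain ⟨w, hw, hwA⟩ := Matrix.exists_vecMul_eq_smul_of_mem_spectrum hl
    refine Module.End.hasEigenvalue_of_hasEigenvector (x := Matrix.vecMulVec v w)
      ⟨Module.End.mem_eigenspace_iff.2 ?_, ?_⟩
    · simp [Matrix.vecMulVec_mul, Matrix.mul_vecMulVec, hAv, hwA, Matrix.vecMulVec_smul,
        Matrix.smul_vecMulVec, sub_smul]
    · exact Matrix.vecMulVec_ne_zero hv hw
end

section
/- Let n ≥ 1 and let A be an n × n complex matrix all of whose eigenvalues are real, with the difference between the largest and smallest eigenvalue strictly less than 1. Then for every integer k ≥ 1, the ℂ-linear map X ↦ X·A − A·X − k·X on the space of n × n complex matrices is bijective. -/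
/-- A semiconjugation `X * A = B * X` is preserved by applying a polynomial. -/
theorem SemiconjBy.polynomial_aeval {R S : Type*} [CommSemiring R] [Semiring S] [Algebra R S]
    {x a b : S} (h : SemiconjBy x a b) (p : Polynomial R) :
    SemiconjBy x (Polynomial.aeval a p) (Polynomial.aeval b p) := by
  induction p using Polynomial.induction_on' with
  | add p q hp hq => simpa only [map_add] using hp.add_right hq
  | monomial m r =>
    simp only [Polynomial.aeval_monomial]
    exact SemiconjBy.mul_right (Algebra.commutes r x).symm (h.pow_right m)

/-- Over an algebraically closed field, a matrix intertwining two matrices with disjoint spectra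
vanishes. -/
theorem Matrix.eq_zero_of_semiconjBy_of_disjoint_spectrum {𝕜 m : Type*} [Field 𝕜] [IsAlgClosed 𝕜]
    [Fintype m] [DecidableEq m] {X A B : Matrix m m 𝕜} (h : SemiconjBy X A B)
    (hAB : Disjoint (spectrum 𝕜 A) (spectrum 𝕜 B)) : X = 0 := by
  cases isEmpty_or_nonempty m
  · exact Subsingleton.elim _ _
  have hX := (h.polynomial_aeval A.charpoly).eq
  rw [Matrix.aeval_self_charpoly, mul_zero] at hX
  have hunit : IsUnit (Polynomial.aeval B A.charpoly) := by
    rw [← spectrum.zero_notMem_iff 𝕜, spectrum.map_polynomial_aeval_of_nonempty B A.charpoly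
      (spectrum.nonempty_of_isAlgClosed_of_finiteDimensional 𝕜 B)]
    rintro ⟨c, hcB, hc⟩
    exact Set.disjoint_left.mp hAB (Matrix.mem_spectrum_iff_isRoot_charpoly.mpr hc) hcB
  exact (hunit.mul_right_eq_zero).mp hX.symm

/-- If all eigenvalues of an `n × n` complex matrix `A` (`n ≥ 1`) are real with spread
strictly less than `1`, then for every integer `k ≥ 1` the `ℂ`-linear map
`X ↦ X·A − A·X − k·X` on `Mₙ(ℂ)` is bijective. -/
theorem commutator_sub_nat_bijective (n : ℕ) (hn : 1 ≤ n)
    (A : Matrix (Fin n) (Fin n) ℂ)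
    (hreal : ∀ c : ℂ, Module.End.HasEigenvalue (Matrix.toLin' A) c → c.im = 0)
    (hspread : ∀ a b : ℂ, Module.End.HasEigenvalue (Matrix.toLin' A) a →
      Module.End.HasEigenvalue (Matrix.toLin' A) b → a.re - b.re < 1) :
    ∀ k : ℤ, 1 ≤ k →
      Function.Bijective
        (fun X : Matrix (Fin n) (Fin n) ℂ => X * A - A * X - (k : ℂ) • X) := by
  intro k hk
  let f : Matrix (Fin n) (Fin n) ℂ →ₗ[ℂ] Matrix (Fin n) (Fin n) ℂ :=
    LinearMap.mulRight ℂ A - LinearMap.mulLeft ℂ A - (k : ℂ) • LinearMap.id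
  have hmem (c : ℂ) : c ∈ spectrum ℂ A ↔ Module.End.HasEigenvalue (Matrix.toLin' A) c := by
    rw [Module.End.hasEigenvalue_iff_mem_spectrum, Matrix.spectrum_toLin']
  have hdisj : Disjoint (spectrum ℂ A) (spectrum ℂ (algebraMap ℂ _ (k : ℂ) + A)) := by
    rw [Set.disjoint_left]
    intro c hc hc'
    rw [← sub_add_cancel c (k : ℂ), spectrum.add_mem_add_iff] at hc'
    have hlt := hspread c (c - k) ((hmem _).mp hc) ((hmem _).mp hc')
    have hk' : (1 : ℝ) ≤ k := by exact_mod_cast hk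
    simp only [Complex.sub_re, Complex.intCast_re] at hlt
    linarith
  have hinj : Function.Injective f := by
    rw [injective_iff_map_eq_zero]
    intro X hX
    refine Matrix.eq_zero_of_semiconjBy_of_disjoint_spectrum ?_ hdisj
    have hX' : X * A - A * X - (k : ℂ) • X = 0 := hX
    rw [SemiconjBy, add_mul, ← Algebra.smul_def, add_comm]
    rwa [sub_sub, sub_eq_zero] at hX'
  exact ⟨hinj, LinearMap.injective_iff_surjective.mp hinj⟩
end

section
/- Let n ≥ 1 and let A = Σ_{k≥1} A_k s^k be a formal power series in s with coefficients A_k in the n × n complex matrices and zero constant term. Assume that for every integer k ≥ 1 the ℂ-linear map X ↦ X·A₁ − A₁·X − k·X on n × n complex matrices is bijective. Then there exists a unique formal power series U = Σ_{k≥0} U_k s^k with matrix coefficients and U₀ equal to the identity matrix such that s·U·A₁ = A·U + s²·U′, where U′ denotes the formal derivative of U with respect to s. Its coefficients satisfy the recursion U_k·A₁ − A₁·U_k − k·U_k = Σ_{j=0}^{k−1} A_{k+1−j}·U_j for k ≥ 1. -/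
/-- The sequence with `U 0 = 1` and `U k = g k (∑ j < k, A (k + 1 - j) * U j)` for `k ≥ 1`. -/
noncomputable def gaugeCoeff {R : Type*} [Ring R] (A : ℕ → R) (g : ℕ → R → R) (k : ℕ) : R :=
  if k = 0 then 1 else g k (∑ j : Fin k, A (k + 1 - j) * gaugeCoeff A g j)
termination_by k
decreasing_by exact j.2

theorem gaugeCoeff_zero {R : Type*} [Ring R] (A : ℕ → R) (g : ℕ → R → R) :
    gaugeCoeff A g 0 = 1 := by
  rw [gaugeCoeff, if_pos rfl]

theorem gaugeCoeff_of_one_le {R : Type*} [Ring R] (A : ℕ → R) (g : ℕ → R → R) {k : ℕ}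
    (hk : 1 ≤ k) :
    gaugeCoeff A g k = g k (∑ j ∈ Finset.range k, A (k + 1 - j) * gaugeCoeff A g j) := by
  rw [gaugeCoeff, if_neg (by omega),
    Fin.sum_univ_eq_sum_range (fun j => A (k + 1 - j) * gaugeCoeff A g j)]

/-- The coefficient of `s ^ (m + 1)` in the gauge equation, solved for `U m`. -/
theorem gauge_coeff_eq_iff {K R : Type*} [Ring R] [SMul K R] {A : ℕ → R} (hA0 : A 0 = 0)
    (U : ℕ → R) (m : ℕ) (c : K) :
    U m * A 1 = (∑ j ∈ Finset.range (m + 2), A (m + 1 - j) * U j) + c • U m ↔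
      U m * A 1 - A 1 * U m - c • U m = ∑ j ∈ Finset.range m, A (m + 1 - j) * U j := by
  rw [Finset.sum_range_succ, Finset.sum_range_succ, Nat.sub_self, hA0, zero_mul, add_zero,
    Nat.add_sub_cancel_left, sub_sub, sub_eq_iff_eq_add, add_assoc]


/-- Let `A = Σ_{k≥1} A_k s^k` be a formal power series with `n × n` complex matrix
coefficients and zero constant term (given by its coefficient family `A : ℕ → Mₙ(ℂ)`,
`A 0 = 0`).  If for every `k ≥ 1` the map `X ↦ X·A₁ − A₁·X − k·X` is bijective, then
there is a unique formal power series `U = Σ_{k≥0} U_k s^k` with `U₀ = 1` satisfying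
`s·U·A₁ = A·U + s²·U′` (stated coefficientwise: comparing the coefficients of `s^{m+1}`
gives `U_m·A₁ = Σ_{j=0}^{m+1} A_{m+1−j}·U_j + m·U_m`), and its coefficients satisfy
`U_k·A₁ − A₁·U_k − k·U_k = Σ_{j=0}^{k−1} A_{k+1−j}·U_j` for `k ≥ 1`. -/
theorem formal_gauge_transformation (n : ℕ) (hn : 1 ≤ n)
    (A : ℕ → Matrix (Fin n) (Fin n) ℂ) (hA0 : A 0 = 0)
    (hbij : ∀ k : ℕ, 1 ≤ k → Function.Bijective
      (fun X : Matrix (Fin n) (Fin n) ℂ => X * A 1 - A 1 * X - (k : ℂ) • X)) :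
    (∃! U : ℕ → Matrix (Fin n) (Fin n) ℂ, U 0 = 1 ∧
      ∀ m : ℕ, U m * A 1 =
        (∑ j ∈ Finset.range (m + 2), A (m + 1 - j) * U j) + (m : ℂ) • U m) ∧
    ∀ U : ℕ → Matrix (Fin n) (Fin n) ℂ,
      (U 0 = 1 ∧ ∀ m : ℕ, U m * A 1 =
        (∑ j ∈ Finset.range (m + 2), A (m + 1 - j) * U j) + (m : ℂ) • U m) →
      ∀ k : ℕ, 1 ≤ k →
        U k * A 1 - A 1 * U k - (k : ℂ) • U k =
          ∑ j ∈ Finset.range k, A (k + 1 - j) * U j := by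
  simp only [gauge_coeff_eq_iff hA0]
  refine ⟨?_, fun U hU k _ => hU.2 k⟩
  choose! g hg using fun k hk => (hbij k hk).surjective
  refine ⟨gaugeCoeff A g, ⟨gaugeCoeff_zero A g, fun m => ?_⟩, fun V ⟨hV0, hV⟩ => ?_⟩
  · rcases Nat.eq_zero_or_pos m with rfl | hm
    · simp [gaugeCoeff_zero]
    · simpa only [← gaugeCoeff_of_one_le A g hm] using
        hg m hm (∑ j ∈ Finset.range m, A (m + 1 - j) * gaugeCoeff A g j)
  · funext k
    induction k using Nat.strong_induction_on with
    | _ k ih =>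
      rcases Nat.eq_zero_or_pos k with rfl | hk
      · rw [hV0, gaugeCoeff_zero]
      · apply (hbij k hk).injective
        rw [gaugeCoeff_of_one_le A g hk, hg k hk]
        refine (hV k).trans (Finset.sum_congr rfl fun j hj => ?_)
        rw [ih j (Finset.mem_range.1 hj)]
end

section
/- Let K be a field of characteristic zero, V a finite-dimensional K-vector space, N a nilpotent K-linear endomorphism of V, and c ∈ ℤ. Then there exists a unique family (W_k)_{k∈ℤ} of K-subspaces of V such that: (i) W_k ⊆ W_{k+1} for all k; (ii) W_k = 0 for all sufficiently small k and W_k = V for all sufficiently large k; (iii) N(W_k) ⊆ W_{k−2} for all k; and (iv) for every integer k ≥ 1, the map from W_{c+k}/W_{c+k−1} to W_{c−k}/W_{c−k−1} induced by N^k is an isomorphism. -/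
section WeightFiltration

variable {R M : Type*} [CommRing R] [AddCommGroup M] [Module R M]

/-- The weight filtration of `N` centered at `0`, as the sum of the submodules
`N ^ j (ker N ^ (i + j + 1)) = ker N ^ (i + 1) ∩ im N ^ j` over all `i - j ≤ k`. -/
def weightFiltration (N : Module.End R M) (k : ℤ) : Submodule R M :=
  ⨆ (i : ℕ) (j : ℕ) (_ : (i : ℤ) - j ≤ k), (LinearMap.ker (N ^ (i + j + 1))).map (N ^ j)

variable {N : Module.End R M}

theorem pow_apply_mem_weightFiltration {k : ℤ} {i j : ℕ} (hij : (i : ℤ) - j ≤ k) {x : M}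
    (hx : (N ^ (i + j + 1)) x = 0) : (N ^ j) x ∈ weightFiltration N k :=
  le_iSup_of_le (f := fun i : ℕ ↦ ⨆ (j : ℕ) (_ : (i : ℤ) - j ≤ k),
      (LinearMap.ker (N ^ (i + j + 1))).map (N ^ j)) i
    (le_iSup₂_of_le j hij le_rfl) (Submodule.mem_map_of_mem hx)

theorem weightFiltration_le {k : ℤ} {P : Submodule R M}
    (h : ∀ i j : ℕ, (i : ℤ) - j ≤ k → ∀ x, (N ^ (i + j + 1)) x = 0 → (N ^ j) x ∈ P) :
    weightFiltration N k ≤ P := by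
  refine iSup_le fun i ↦ iSup₂_le fun j hij ↦ ?_
  rintro _ ⟨x, hx, rfl⟩
  exact h i j hij x hx

theorem weightFiltration_mono : Monotone (weightFiltration N) := fun _ _ h ↦
  weightFiltration_le fun _ _ hij _ hx ↦ pow_apply_mem_weightFiltration (hij.trans h) hx

theorem mem_weightFiltration_of_pow_apply_eq_zero {k : ℤ} {i : ℕ} (hi : (i : ℤ) ≤ k) {x : M}
    (hx : (N ^ (i + 1)) x = 0) : x ∈ weightFiltration N k :=
  pow_apply_mem_weightFiltration (i := i) (j := 0) (by simpa using hi) hx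

theorem apply_mem_weightFiltration {k l : ℤ} (hl : k - 2 ≤ l) {x : M}
    (hx : x ∈ weightFiltration N k) : N x ∈ weightFiltration N l := by
  suffices h : weightFiltration N k ≤ (weightFiltration N l).comap N from h hx
  refine weightFiltration_le fun i j hij y hy ↦ ?_
  rw [Submodule.mem_comap, ← Module.End.mul_apply, ← pow_succ']
  rcases i with _ | i
  · have : (N ^ (j + 1)) y = 0 := by simpa using hy
    simp [this]
  · exact pow_apply_mem_weightFiltration (i := i) (by push_cast at hij ⊢; omega)
      (by rwa [show i + (j + 1) + 1 = i + 1 + j + 1 by omega])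

theorem exists_pow_apply_eq_of_mem_weightFiltration {k : ℕ} {x : M}
    (hx : x ∈ weightFiltration N (-k)) : ∃ y ∈ weightFiltration N k, (N ^ k) y = x := by
  suffices h : weightFiltration N (-k) ≤ (weightFiltration N k).map (N ^ k) from h hx
  refine weightFiltration_le fun i j hij z hz ↦ ?_
  obtain ⟨m, rfl⟩ : ∃ m, j = k + m := ⟨j - k, by omega⟩
  refine ⟨(N ^ m) z, pow_apply_mem_weightFiltration (i := i + k) (by push_cast at hij ⊢; omega)
    (by rwa [show i + k + m + 1 = i + (k + m) + 1 by omega]), ?_⟩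
  rw [pow_add, Module.End.mul_apply]

theorem mem_weightFiltration_of_pow_apply_mem {k : ℕ} (hk : 1 ≤ k) {x : M}
    (hx : (N ^ k) x ∈ weightFiltration N (-k - 1)) : x ∈ weightFiltration N (k - 1) := by
  obtain ⟨y, hy, hyx⟩ := exists_pow_apply_eq_of_mem_weightFiltration (k := k + 1)
    (x := (N ^ k) x) (by convert hx using 2; push_cast; ring)
  rw [← sub_add_cancel x (N y)]
  refine add_mem (mem_weightFiltration_of_pow_apply_eq_zero (i := k - 1) (by omega) ?_)
    (apply_mem_weightFiltration (by push_cast; omega) hy)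
  rw [Nat.sub_add_cancel hk, map_sub, ← hyx, pow_succ, Module.End.mul_apply, sub_self]

theorem weightFiltration_eq_bot {d : ℕ} (hd : N ^ d = 0) {k : ℤ} (hk : k ≤ -d) :
    weightFiltration N k = ⊥ := by
  refine le_bot_iff.1 (weightFiltration_le fun i j hij x _ ↦ ?_)
  rw [pow_eq_zero_of_le (show d ≤ j by omega) hd]
  simp

theorem weightFiltration_eq_top {d : ℕ} (hd : N ^ d = 0) {k : ℤ} (hk : d ≤ k) :
    weightFiltration N k = ⊤ :=
  top_le_iff.1 fun x _ ↦ mem_weightFiltration_of_pow_apply_eq_zero hk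
    (by simp [pow_succ', hd])

theorem eq_weightFiltration {W : ℤ → Submodule R M} (hmono : Monotone W)
    {a : ℤ} (ha : ∀ k ≤ a, W k = ⊥) {b : ℤ} (hb : ∀ k, b ≤ k → W k = ⊤)
    (hN : ∀ k, ∀ x ∈ W k, N x ∈ W (k - 2))
    (hinj : ∀ k : ℕ, 1 ≤ k → ∀ x ∈ W k, (N ^ k) x ∈ W (-k - 1) → x ∈ W (k - 1))
    (hsurj : ∀ k : ℕ, 1 ≤ k → ∀ y ∈ W (-k), ∃ x ∈ W k, y - (N ^ k) x ∈ W (-k - 1)) :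
    W = weightFiltration N := by
  have hpow (j : ℕ) : ∀ k, ∀ x ∈ W k, (N ^ j) x ∈ W (k - 2 * j) := by
    induction j with
    | zero => simp
    | succ j ih =>
      intro k x hx
      rw [pow_succ', Module.End.mul_apply]
      convert hN _ _ (ih k x hx) using 2
      push_cast; ring
  have hker (i : ℕ) (x : M) (hx : (N ^ (i + 1)) x = 0) : x ∈ W i := by
    have key (n : ℕ) : x ∈ W (i + n) → x ∈ W i := by
      induction n with
      | zero => simp
      | succ n ih =>
        intro h
        have h0 : (N ^ (i + n + 1)) x = 0 := by
          rw [show i + n + 1 = n + (i + 1) by omega, pow_add, Module.End.mul_apply, hx, map_zero]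
        have := hinj (i + n + 1) (by omega) x (by convert h using 2; push_cast; ring)
          (by simp [h0])
        exact ih (by convert this using 2; push_cast; ring)
    exact key b.toNat (by rw [hb _ (by omega)]; trivial)
  have hge (k : ℤ) : weightFiltration N k ≤ W k := weightFiltration_le fun i j hij x hx ↦
    hmono (by push_cast; omega) (hpow j _ x (hker (i + j) x hx))
  have himage (n : ℕ) : ∀ k : ℕ, -a ≤ k + n → ∀ y ∈ W (-k), ∃ x ∈ W k, (N ^ k) x = y := by
    induction n with
    | zero =>
      intro k hk y hy
      rw [ha _ (by push_cast at hk; omega), Submodule.mem_bot] at hy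
      exact ⟨0, zero_mem _, by simp [hy]⟩
    | succ n ih =>
      intro k hk y hy
      rcases Nat.eq_zero_or_pos k with rfl | hpos
      · exact ⟨y, by simpa using hy, by simp⟩
      obtain ⟨x, hx, hxy⟩ := hsurj k hpos y hy
      obtain ⟨z, hz, hzx⟩ := ih (k + 1) (by push_cast at hk ⊢; omega) _
        (by convert hxy using 2; push_cast; ring)
      refine ⟨x + N z, add_mem hx (hmono (by push_cast; omega) (hN _ z hz)), ?_⟩
      rw [map_add, ← Module.End.mul_apply, ← pow_succ, hzx, add_sub_cancel]
  have himage (k : ℕ) : ∀ y ∈ W (-k), ∃ x ∈ W k, (N ^ k) x = y :=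
    himage (-a).toNat k (by omega)
  have hle (n : ℕ) : ∀ k : ℕ, -a ≤ k + n → W k ≤ weightFiltration N k := by
    induction n with
    | zero =>
      intro k hk x hx
      have h0 : (N ^ (k + 1)) x = 0 := by
        have := hpow (k + 1) _ x hx
        rwa [ha _ (by push_cast at hk ⊢; omega), Submodule.mem_bot] at this
      exact mem_weightFiltration_of_pow_apply_eq_zero le_rfl h0
    | succ n ih =>
      intro k hk x hx
      obtain ⟨y, hy, hyx⟩ := himage (k + 2) ((N ^ (k + 1)) x)
        (by convert hpow (k + 1) _ x hx using 2; push_cast; ring)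
      have hy' := ih (k + 2) (by push_cast at hk ⊢; omega) hy
      rw [← sub_add_cancel x (N y)]
      refine add_mem (mem_weightFiltration_of_pow_apply_eq_zero le_rfl ?_)
        (apply_mem_weightFiltration (by push_cast; omega) hy')
      rw [map_sub, ← hyx, ← Module.End.mul_apply, ← pow_succ, sub_self]
  have hle (k : ℕ) : W k ≤ weightFiltration N k := hle (-a).toNat k (by omega)
  refine funext fun k ↦ le_antisymm (fun x hx ↦ ?_) (hge k)
  obtain ⟨n, rfl | rfl⟩ := k.eq_nat_or_neg
  · exact hle n hx
  · obtain ⟨y, hy, rfl⟩ := himage n x hx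
    have hpow' (j : ℕ) : (N ^ j) y ∈ weightFiltration N (n - 2 * j) := by
      induction j with
      | zero => simpa using hle n hy
      | succ j ih =>
        rw [pow_succ', Module.End.mul_apply]
        exact apply_mem_weightFiltration (by push_cast; omega) ih
    exact weightFiltration_mono (by omega) (hpow' n)

end WeightFiltration

/-- Existence and uniqueness of the monodromy weight filtration centered at `c` of a
nilpotent endomorphism `N` of a finite-dimensional vector space over a field of
characteristic zero: there is a unique increasing exhaustive filtration `(W_k)_{k∈ℤ}`
with `N(W_k) ⊆ W_{k−2}` such that for every `k ≥ 1` the map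
`W_{c+k}/W_{c+k−1} → W_{c−k}/W_{c−k−1}` induced by `N^k` is an isomorphism (stated
elementwise: it is injective and surjective). -/
theorem weight_filtration_exists_unique {K : Type*} [Field K] [CharZero K]
    {V : Type*} [AddCommGroup V] [Module K V] [FiniteDimensional K V]
    (N : Module.End K V) (hN : IsNilpotent N) (c : ℤ) :
    ∃! W : ℤ → Submodule K V,
      (∀ k : ℤ, W k ≤ W (k + 1)) ∧
      (∃ a : ℤ, ∀ k ≤ a, W k = ⊥) ∧
      (∃ b : ℤ, ∀ k : ℤ, b ≤ k → W k = ⊤) ∧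
      (∀ k : ℤ, ∀ x ∈ W k, N x ∈ W (k - 2)) ∧
      (∀ k : ℕ, 1 ≤ k →
        (∀ x ∈ W (c + k), (N ^ k) x ∈ W (c - k - 1) → x ∈ W (c + k - 1)) ∧
        (∀ y ∈ W (c - k), ∃ x ∈ W (c + k), y - (N ^ k) x ∈ W (c - k - 1))) := by
  obtain ⟨d, hd⟩ := hN
  refine ⟨fun k ↦ weightFiltration N (k - c), ⟨fun k ↦ weightFiltration_mono (by omega),
    ⟨c - d, fun k hk ↦ weightFiltration_eq_bot hd (by omega)⟩,
    ⟨c + d, fun k hk ↦ weightFiltration_eq_top hd (by omega)⟩,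
    fun k x hx ↦ apply_mem_weightFiltration (by omega) hx, fun k hk ↦ ⟨fun x _ hx ↦ ?_,
      fun y hy ↦ ?_⟩⟩, ?_⟩
  · beta_reduce at hx ⊢
    rw [show c + k - 1 - c = (k : ℤ) - 1 by ring]
    rw [show c - k - 1 - c = -(k : ℤ) - 1 by ring] at hx
    exact mem_weightFiltration_of_pow_apply_mem hk hx
  · beta_reduce at hy ⊢
    rw [show c - k - c = -(k : ℤ) by ring] at hy
    obtain ⟨x, hx, rfl⟩ := exists_pow_apply_eq_of_mem_weightFiltration hy
    exact ⟨x, by simpa using hx, by simp⟩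
  · rintro W ⟨hmono, ⟨a, ha⟩, ⟨b, hb⟩, hW, hiso⟩
    have hshift : (fun k ↦ W (c + k)) = weightFiltration N := by
      refine eq_weightFiltration
        (fun k l hkl ↦ monotone_int_of_le_succ hmono (by omega : c + k ≤ c + l))
        (a := a - c) (fun k hk ↦ ha _ (by omega)) (b := b - c) (fun k hk ↦ hb _ (by omega))
        (fun k x hx ↦ ?_) (fun k hk x hx hNx ↦ ?_) (fun k hk y hy ↦ ?_)
      · simpa only [add_sub_assoc] using hW _ x hx
      · simpa only [add_sub_assoc] using (hiso k hk).1 x hx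
          (by convert hNx using 2; ring)
      · obtain ⟨x, hx, hxy⟩ := (hiso k hk).2 y (by convert hy using 2; ring)
        exact ⟨x, hx, by convert hxy using 2; ring⟩
    funext k
    simpa using congrFun hshift (k - c)
end
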